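/- There is no 8×8 real matrix B satisfying all of: Bᵀη = −ηB (B ∈ so(4,4)); [B, J_k] ∈ span_ℝ{J₁, J₂, J₃} for k = 1, 2, 3 (B normalizes V = span{J₁, J₂, J₃}); [B, J₁] = 0; and B·(e₁ + e₅) = J₁·(e₁ + e₅). (This is the algebraic obstruction showing that the 11-dimensional pseudo H-type group N_{2,1} is not a geodesic orbit manifold.) -/

import Mathlib

open Matrix

noncomputable section

/-- `η = diag(1,1,1,1,−1,−1,−1,−1)`. -/
def η : Matrix (Fin 8) (Fin 8) ℝ :=
  Matrix.diagonal ![1, 1, 1, 1, -1, -1, -1, -1]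

/-- The Clifford map `J_{Z₁}` of the pseudo H-type Lie algebra `n_{2,1}`. -/
def J1 : Matrix (Fin 8) (Fin 8) ℝ :=
  !![0,-1,0,0,0,0,0,0;
     1,0,0,0,0,0,0,0;
     0,0,0,-1,0,0,0,0;
     0,0,1,0,0,0,0,0;
     0,0,0,0,0,-1,0,0;
     0,0,0,0,1,0,0,0;
     0,0,0,0,0,0,0,-1;
     0,0,0,0,0,0,1,0]

/-- The Clifford map `J_{Z₂}` of the pseudo H-type Lie algebra `n_{2,1}`. -/
def J2 : Matrix (Fin 8) (Fin 8) ℝ :=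
  !![0,0,-1,0,0,0,0,0;
     0,0,0,1,0,0,0,0;
     1,0,0,0,0,0,0,0;
     0,-1,0,0,0,0,0,0;
     0,0,0,0,0,0,-1,0;
     0,0,0,0,0,0,0,1;
     0,0,0,0,1,0,0,0;
     0,0,0,0,0,-1,0,0]

/-- The Clifford map `J_{Z₃}` of the pseudo H-type Lie algebra `n_{2,1}`. -/
def J3 : Matrix (Fin 8) (Fin 8) ℝ :=
  !![0,0,0,0,1,0,0,0;
     0,0,0,0,0,-1,0,0;
     0,0,0,0,0,0,-1,0;
     0,0,0,0,0,0,0,1;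
     1,0,0,0,0,0,0,0;
     0,-1,0,0,0,0,0,0;
     0,0,-1,0,0,0,0,0;
     0,0,0,1,0,0,0,0]

theorem aux13 : J1 * J3 = -(J3 * J1) := by
  ext i j
  fin_cases i <;> fin_cases j <;> simp [J1, J3, Matrix.mul_apply, Fin.sum_univ_eight]

theorem aux12 : J1 * J2 = -(J2 * J1) := by
  ext i j
  fin_cases i <;> fin_cases j <;> simp [J1, J2, Matrix.mul_apply, Fin.sum_univ_eight]

theorem aux11 : J1 * J1 = -1 := by
  ext i j
  fin_cases i <;> fin_cases j <;> simp [J1, Matrix.mul_apply, Fin.sum_univ_eight]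

theorem aux3x : J3.mulVec ![1, 0, 0, 0, 1, 0, 0, 0] = ![1, 0, 0, 0, 1, 0, 0, 0] := by
  ext i
  fin_cases i <;> simp [J3, Matrix.mulVec, dotProduct, Fin.sum_univ_eight]

/-- There is no `B ∈ so(4,4)` normalizing `V = span{J₁,J₂,J₃}` with `[B,J₁] = 0`
and `B·(e₁+e₅) = J₁·(e₁+e₅)`: the obstruction showing that `N_{2,1}` is not
geodesic orbit. -/
theorem statement17 :
    ¬ ∃ B : Matrix (Fin 8) (Fin 8) ℝ,
      B.transpose * η = -(η * B) ∧
      (B * J1 - J1 * B) ∈ Submodule.span ℝ {J1, J2, J3} ∧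
      (B * J2 - J2 * B) ∈ Submodule.span ℝ {J1, J2, J3} ∧
      (B * J3 - J3 * B) ∈ Submodule.span ℝ {J1, J2, J3} ∧
      B * J1 - J1 * B = 0 ∧
      B.mulVec ![1, 0, 0, 0, 1, 0, 0, 0] = J1.mulVec ![1, 0, 0, 0, 1, 0, 0, 0] := by
  rintro ⟨B, -, -, -, h4, h5, h6⟩
  obtain ⟨a, b, c, hC⟩ := Submodule.mem_span_triple.1 h4
  have hB1 : B * J1 = J1 * B := sub_eq_zero.1 h5
  -- the commutator with `J3` anticommutes with `J1`
  have hanti : J1 * (B * J3 - J3 * B) + (B * J3 - J3 * B) * J1 = 0 := by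
    have e1 : J1 * (B * J3) = -(B * (J3 * J1)) := by
      rw [← mul_assoc, ← hB1, mul_assoc, aux13, mul_neg]
    have e2 : J1 * (J3 * B) = -(J3 * (B * J1)) := by
      rw [← mul_assoc, aux13, neg_mul, mul_assoc, ← hB1]
    rw [mul_sub, sub_mul, e1, e2, mul_assoc, mul_assoc]
    abel
  have ha : a = 0 := by
    rw [← hC] at hanti
    simp only [mul_add, add_mul, Matrix.mul_smul, Matrix.smul_mul, aux11, aux12, aux13] at hanti
    have h := congrFun (congrFun hanti 0) 0
    simp at h
    linarith
  -- evaluate the commutator with `J3` on `e₁ + e₅`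
  have hv : (B * J3 - J3 * B).mulVec ![1, 0, 0, 0, 1, 0, 0, 0]
      = (2 : ℝ) • J1.mulVec ![1, 0, 0, 0, 1, 0, 0, 0] := by
    rw [Matrix.sub_mulVec, ← Matrix.mulVec_mulVec, ← Matrix.mulVec_mulVec, aux3x, h6,
      Matrix.mulVec_mulVec, ← neg_neg (J3 * J1), ← aux13, Matrix.neg_mulVec,
      ← Matrix.mulVec_mulVec, aux3x, two_smul, sub_neg_eq_add]
  rw [← hC] at hv
  have h := congrFun hv 1
  simp [J1, J2, J3, Matrix.mulVec, dotProduct, Fin.sum_univ_eight] at h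
  linarith

end
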